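/- With D₀ and Δ_k as in the decomposition of the truncated Hilbert kernel (D₀(y) = ζ(y)/y − iπ(Ψ₀(y) − conj(Ψ₀(y))), Δ̂_k(ξ) = D̂₀(ξ) χ(2^k ξ) for a smooth χ supported in {1/2 ≤ |ξ| ≤ 2} forming a partition of unity under dyadic dilations), the following hold with implied constants independent of k ∈ ℤ: (i) ‖Δ̂_k‖_{L^∞} ≲ 2^{−|k|}; (ii) Δ̂_k is supported in { ξ : 2^{−k−1} ≤ |ξ| ≤ 2^{−k+1} }; (iii) |Δ_k(y)| ≲ 2^{−k−|k|} (1 + 2^{−k}|y|)^{−ν} for all y ∈ ℝ, where ν is the large fixed constant of the construction. -/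

import Mathlib

open MeasureTheory Filter Set
open scoped ENNReal

/-- The (principal value) Fourier transform `K̂_H(ξ) = p.v. ∫ ζ(y) e^{iξy} dy/y`. -/
noncomputable def hatKH (ζ : ℝ → ℝ) (ξ : ℝ) : ℂ :=
  limUnder (nhdsWithin (0 : ℝ) (Set.Ioi 0))
    (fun ε => ∫ y in {y : ℝ | ε < |y|}, (ζ y : ℂ) * Complex.exp (Complex.I * ξ * y) / (y : ℂ))

/-- The Fourier transform of `D₀(y) = ζ(y)/y − iπ (Ψ₀(y) − conj Ψ₀(y))`, expressed through the
Fourier transform `hΨ₀` of `Ψ₀` (with the convention `ĝ(ξ) = ∫ g(y) e^{iξy} dy`, the transform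
of `conj Ψ₀` at `ξ` is `conj (hΨ₀(−ξ))`). -/
noncomputable def hatD0 (ζ : ℝ → ℝ) (hΨ₀ : ℝ → ℂ) (ξ : ℝ) : ℂ :=
  hatKH ζ ξ - (Real.pi : ℂ) * Complex.I * (hΨ₀ ξ - (starRingEnd ℂ) (hΨ₀ (-ξ)))

/-- `Δ̂_k(ξ) = D̂₀(ξ) χ(2^k ξ)`. -/
noncomputable def hatDeltaK (ζ : ℝ → ℝ) (hΨ₀ : ℝ → ℂ) (χ : ℝ → ℝ) (k : ℤ) (ξ : ℝ) : ℂ :=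
  hatD0 ζ hΨ₀ ξ * ((χ ((2 : ℝ) ^ k * ξ) : ℝ) : ℂ)

/-- The piece `Δ_k`, recovered from its compactly supported Fourier transform by inversion. -/
noncomputable def deltaK (ζ : ℝ → ℝ) (hΨ₀ : ℝ → ℂ) (χ : ℝ → ℝ) (k : ℤ) : ℝ → ℂ :=
  fun y => ((2 * Real.pi : ℝ) : ℂ)⁻¹ *
    ∫ ξ : ℝ, hatDeltaK ζ hΨ₀ χ k ξ * Complex.exp (-(Complex.I * ξ * y))

lemma integral_eq_integral_of_add_neg_eq {E : Type*} [NormedAddCommGroup E] [NormedSpace ℝ E]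
    {f g : ℝ → E} (hf : Integrable f) (h : ∀ y, f y + f (-y) = (2 : ℝ) • g y) :
    ∫ y, f y = ∫ y, g y := by
  have h1 : ∫ y, (f y + f (-y)) = (2 : ℝ) • ∫ y, f y := by
    rw [integral_add hf hf.comp_neg, integral_neg_eq_self f, two_smul]
  simp_rw [h, integral_smul] at h1
  exact (smul_right_injective E (two_ne_zero (α := ℝ)) h1).symm

lemma abs_sin_mul_div_le (ξ y : ℝ) : |Real.sin (ξ * y) / y| ≤ |ξ| := by
  rcases eq_or_ne y 0 with rfl | hy
  · simp
  · rw [abs_div, div_le_iff₀ (abs_pos.2 hy), ← abs_mul]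
    exact Real.abs_sin_le_abs

lemma integrable_mul_sin_div {ζ : ℝ → ℝ} (hζ : Integrable ζ) (ξ : ℝ) :
    Integrable (fun y => ζ y * (Real.sin (ξ * y) / y)) :=
  hζ.mul_bdd (c := |ξ|)
    (by fun_prop : Measurable fun y => Real.sin (ξ * y) / y).aestronglyMeasurable
    (ae_of_all _ fun y => abs_sin_mul_div_le ξ y)

lemma setIntegral_mul_exp_div {ζ : ℝ → ℝ} (hζ : Integrable ζ) (hζeven : ∀ y : ℝ, ζ (-y) = ζ y)
    (ξ : ℝ) {ε : ℝ} (hε : 0 < ε) :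
    ∫ y in {y : ℝ | ε < |y|}, (ζ y : ℂ) * Complex.exp (Complex.I * ξ * y) / (y : ℂ) =
      ∫ y, {y : ℝ | ε < |y|}.indicator
        (fun y => Complex.I * ((ζ y * (Real.sin (ξ * y) / y) : ℝ) : ℂ)) y := by
  have hS : MeasurableSet {y : ℝ | ε < |y|} := measurableSet_lt measurable_const (by fun_prop)
  rw [← integral_indicator hS]
  refine integral_eq_integral_of_add_neg_eq ?_ fun y => ?_
  · rw [integrable_indicator_iff hS]
    refine Integrable.mono' (g := fun y => ε⁻¹ * ‖ζ y‖) (hζ.norm.const_mul _).integrableOn ?_ ?_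
    · have := hζ.aemeasurable.restrict (s := {y : ℝ | ε < |y|})
      exact AEMeasurable.aestronglyMeasurable (by fun_prop)
    · filter_upwards [ae_restrict_mem hS] with y hy
      have hy' : ε < |y| := hy
      have h1 : ‖Complex.exp (Complex.I * ξ * y)‖ = 1 := by
        rw [mul_assoc, mul_comm, ← Complex.ofReal_mul, Complex.norm_exp_ofReal_mul_I]
      rw [norm_div, norm_mul, h1, mul_one, Complex.norm_real, Complex.norm_real, div_eq_inv_mul]
      gcongr
      exact hy'.le
  · by_cases hy : ε < |y|
    · have hy0 : (y : ℂ) ≠ 0 := by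
        rintro h
        simp [Complex.ofReal_eq_zero.1 h] at hy
        linarith
      have e1 : Complex.I * ξ * y = ((ξ * y : ℝ) : ℂ) * Complex.I := by push_cast; ring
      have e2 : Complex.I * ξ * ((-y : ℝ) : ℂ) = ((-(ξ * y) : ℝ) : ℂ) * Complex.I := by
        push_cast; ring
      simp only [Set.indicator, Set.mem_ofPred_eq, abs_neg, hy, if_true, hζeven]
      rw [e1, e2, Complex.exp_mul_I, Complex.exp_mul_I, ← Complex.ofReal_cos, ← Complex.ofReal_sin,
        ← Complex.ofReal_cos, ← Complex.ofReal_sin, Real.cos_neg, Real.sin_neg, Complex.real_smul]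
      push_cast
      field_simp
      ring
    · simp [Set.indicator, hy]

/-- The principal value transform of an even density is a convergent sine integral. -/
lemma hatKH_eq {ζ : ℝ → ℝ} (hζ : Integrable ζ) (hζeven : ∀ y : ℝ, ζ (-y) = ζ y) (ξ : ℝ) :
    hatKH ζ ξ = Complex.I * ((∫ y, ζ y * (Real.sin (ξ * y) / y) : ℝ) : ℂ) := by
  refine Tendsto.limUnder_eq ?_
  have key : Tendsto (fun ε : ℝ => ∫ y, {y : ℝ | ε < |y|}.indicator
      (fun y => Complex.I * ((ζ y * (Real.sin (ξ * y) / y) : ℝ) : ℂ)) y)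
      (nhdsWithin (0 : ℝ) (Set.Ioi 0))
      (nhds (∫ y, Complex.I * ((ζ y * (Real.sin (ξ * y) / y) : ℝ) : ℂ))) := by
    have hint : Integrable (fun y => Complex.I * ((ζ y * (Real.sin (ξ * y) / y) : ℝ) : ℂ)) :=
      (integrable_mul_sin_div hζ ξ).ofReal.const_mul _
    refine tendsto_integral_filter_of_dominated_convergence _
      (Eventually.of_forall fun ε => ?_) (Eventually.of_forall fun ε => ae_of_all _ fun y =>
        norm_indicator_le_norm_self _ y) hint.norm ?_
    · exact hint.aestronglyMeasurable.indicator (measurableSet_lt measurable_const (by fun_prop))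
    · filter_upwards [Measure.ae_ne volume (0 : ℝ)] with y hy
      refine tendsto_const_nhds.congr' ?_
      filter_upwards [mem_nhdsWithin_of_mem_nhds (Iio_mem_nhds (abs_pos.2 hy))] with ε hε
      exact (Set.indicator_of_mem (s := {y : ℝ | ε < |y|}) hε
        fun y => Complex.I * ((ζ y * (Real.sin (ξ * y) / y) : ℝ) : ℂ)).symm
  rw [integral_const_mul, integral_complex_ofReal] at key
  refine key.congr' ?_
  filter_upwards [self_mem_nhdsWithin] with ε hε
  exact (setIntegral_mul_exp_div hζ hζeven ξ hε).symm

lemma hasDerivAt_hatKH {ζ : ℝ → ℝ} (hζ : Integrable ζ) (hζeven : ∀ y : ℝ, ζ (-y) = ζ y) (ξ : ℝ) :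
    HasDerivAt (hatKH ζ) (Complex.I * ((∫ y, ζ y * Real.cos (ξ * y) : ℝ) : ℂ)) ξ := by
  have h : HasDerivAt (fun ξ : ℝ => ∫ y, ζ y * (Real.sin (ξ * y) / y))
      (∫ y, ζ y * Real.cos (ξ * y)) ξ := by
    have hm := hζ.aestronglyMeasurable
    refine (hasDerivAt_integral_of_dominated_loc_of_deriv_le (bound := fun y => ‖ζ y‖)
      (F' := fun x y => ζ y * Real.cos (x * y)) univ_mem
      (Eventually.of_forall fun x => (integrable_mul_sin_div hζ x).aestronglyMeasurable)
      (integrable_mul_sin_div hζ ξ) (by fun_prop) (ae_of_all _ fun y x _ => ?_) hζ.norm ?_).2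
    · rw [norm_mul]
      exact mul_le_of_le_one_right (norm_nonneg _) (Real.abs_cos_le_one _)
    · filter_upwards [Measure.ae_ne volume (0 : ℝ)] with y hy x _
      have := ((((hasDerivAt_id x).mul_const y).sin).div_const y).const_mul (ζ y)
      simpa [hy] using this
  rw [show hatKH ζ = _ from funext (hatKH_eq hζ hζeven)]
  exact h.ofReal_comp.const_mul _

/-- The cosine transform of a test function is a Schwartz function. -/
lemma exists_schwartzMap_eq_cosine_transform {ζ : ℝ → ℝ} (hζsmooth : ContDiff ℝ (⊤ : ℕ∞) ζ)
    (hζcompact : HasCompactSupport ζ) (hζeven : ∀ y : ℝ, ζ (-y) = ζ y) :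
    ∃ G : SchwartzMap ℝ ℂ, ∀ ξ, G ξ = ((∫ y, ζ y * Real.cos (ξ * y) : ℝ) : ℂ) := by
  have h1 : HasCompactSupport (fun y => (ζ y : ℂ)) := hζcompact.comp_left Complex.ofReal_zero
  have h2 : ContDiff ℝ (⊤ : ℕ∞) (fun y => (ζ y : ℂ)) := Complex.ofRealCLM.contDiff.comp hζsmooth
  have hπ : (2 * Real.pi)⁻¹ ≠ 0 := by positivity
  refine ⟨SchwartzMap.compCLMOfContinuousLinearEquiv ℂ
    (ContinuousLinearEquiv.unitsEquivAut ℝ (Units.mk0 _ hπ))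
    (FourierTransform.fourier (h1.toSchwartzMap h2)), fun ξ => ?_⟩
  rw [SchwartzMap.compCLMOfContinuousLinearEquiv_apply, Function.comp_apply,
    SchwartzMap.fourier_coe, Real.fourier_real_eq_integral_exp_smul, ← integral_complex_ofReal]
  have hint : Integrable (fun y => (ζ y : ℂ)) :=
    h2.continuous.integrable_of_hasCompactSupport h1
  refine integral_eq_integral_of_add_neg_eq ?_ fun y => ?_
  · refine hint.bdd_mul (c := 1) (by fun_prop) (ae_of_all _ fun y => ?_)
    rw [Complex.norm_exp_ofReal_mul_I]
  · have e (y : ℝ) : -2 * Real.pi * y * (ξ * (2 * Real.pi)⁻¹) = -(ξ * y) := by field_simp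
    simp only [ContinuousLinearEquiv.unitsEquivAut_apply, Units.val_mk0,
      HasCompactSupport.toSchwartzMap_toFun, smul_eq_mul, hζeven, e]
    simp only [mul_neg, neg_neg]
    rw [Complex.exp_mul_I, Complex.exp_mul_I, ← Complex.ofReal_cos, ← Complex.ofReal_sin,
        ← Complex.ofReal_cos, ← Complex.ofReal_sin, Real.cos_neg, Real.sin_neg, Complex.real_smul]
    push_cast
    ring

lemma hatD0_neg {ζ : ℝ → ℝ} (hζ : Integrable ζ) (hζeven : ∀ y : ℝ, ζ (-y) = ζ y)
    (hΨ₀ : ℝ → ℂ) (ξ : ℝ) :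
    hatD0 ζ hΨ₀ (-ξ) = (starRingEnd ℂ) (hatD0 ζ hΨ₀ ξ) := by
  have h : ∫ y, ζ y * (Real.sin (-ξ * y) / y) = -∫ y, ζ y * (Real.sin (ξ * y) / y) := by
    rw [← integral_neg]
    congr with y
    rw [neg_mul, Real.sin_neg]
    ring
  simp only [hatD0, hatKH_eq hζ hζeven, h, map_sub, map_mul, Complex.conj_I, Complex.conj_ofReal,
    Complex.conj_conj, neg_neg]
  push_cast
  ring

lemma hatD0_zero {ζ : ℝ → ℝ} (hζ : Integrable ζ) (hζeven : ∀ y : ℝ, ζ (-y) = ζ y)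
    {hΨ₀ : ℝ → ℂ} (h0 : hΨ₀ 0 = 0) : hatD0 ζ hΨ₀ 0 = 0 := by
  simp [hatD0, hatKH_eq hζ hζeven, h0]

lemma hasCompactSupport_deriv_of_eq_const {E : Type*} [NormedAddCommGroup E] [NormedSpace ℝ E]
    {m : ℝ → E} {a b : E} {R : ℝ} (hl : ∀ x < -R, m x = a) (hr : ∀ x, R < x → m x = b) :
    HasCompactSupport (deriv m) := by
  refine HasCompactSupport.intro (isCompact_Icc (a := -R) (b := R)) fun x hx => ?_
  rw [Set.mem_Icc, not_and_or, not_le, not_le] at hx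
  rcases hx with hx | hx
  · have : m =ᶠ[nhds x] fun _ => a := by
      filter_upwards [Iio_mem_nhds hx] with y hy using hl y hy
    rw [this.deriv_eq, deriv_const]
  · have : m =ᶠ[nhds x] fun _ => b := by
      filter_upwards [Ioi_mem_nhds hx] with y hy using hr y hy
    rw [this.deriv_eq, deriv_const]

/-- The symbol `D̂₀` has a Schwartz derivative. -/
lemma exists_schwartzMap_hasDerivAt_hatD0 {ζ : ℝ → ℝ} (hζsmooth : ContDiff ℝ (⊤ : ℕ∞) ζ)
    (hζcompact : HasCompactSupport ζ) (hζeven : ∀ y : ℝ, ζ (-y) = ζ y)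
    {hΨ₀ : ℝ → ℂ} (hΨ₀smooth : ContDiff ℝ (⊤ : ℕ∞) hΨ₀)
    {c : ℂ} (hlow : ∀ ξ : ℝ, ξ < -1 → hΨ₀ ξ = c)
    (hhigh : ∀ ξ : ℝ, -(1 / 2 : ℝ) < ξ → hΨ₀ ξ = 0) :
    ∃ G : SchwartzMap ℝ ℂ, ∀ ξ, HasDerivAt (hatD0 ζ hΨ₀) (G ξ) ξ := by
  obtain ⟨A, hA⟩ := exists_schwartzMap_eq_cosine_transform hζsmooth hζcompact hζeven
  have hm : ContDiff ℝ (⊤ : ℕ∞) (fun ξ => hΨ₀ ξ - (starRingEnd ℂ) (hΨ₀ (-ξ))) :=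
    hΨ₀smooth.sub (Complex.conjCLE.contDiff.comp (hΨ₀smooth.comp contDiff_neg))
  have hm' : HasCompactSupport (deriv fun ξ => hΨ₀ ξ - (starRingEnd ℂ) (hΨ₀ (-ξ))) := by
    refine hasCompactSupport_deriv_of_eq_const (R := 1) (a := c) (b := -(starRingEnd ℂ) c)
      (fun x hx => ?_) (fun x hx => ?_)
    · rw [hlow x hx, hhigh (-x) (by linarith), map_zero, sub_zero]
    · rw [hhigh x (by linarith), hlow (-x) (by linarith), zero_sub]
  have hm'' := (contDiff_infty_iff_deriv.1 hm).2
  refine ⟨Complex.I • A - ((Real.pi : ℂ) * Complex.I) • hm'.toSchwartzMap hm'', fun ξ => ?_⟩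
  have hζ := hζsmooth.continuous.integrable_of_hasCompactSupport hζcompact (μ := volume)
  have h1 := hasDerivAt_hatKH hζ hζeven ξ
  rw [← hA ξ] at h1
  have h2 := (hm.differentiable (by simp) ξ).hasDerivAt
  exact h1.sub (h2.const_mul _)

lemma norm_le_div_of_hasDerivAt_of_tendsto {E : Type*} [NormedAddCommGroup E] [NormedSpace ℝ E]
    [CompleteSpace E] {D G : ℝ → E} (hG : Integrable G) (hD : ∀ x, HasDerivAt D (G x) x)
    (htop : Tendsto D atTop (nhds 0)) {B : ℝ} (hB : ∀ x, |x| ^ 2 * ‖G x‖ ≤ B) {x : ℝ}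
    (hx : 0 < x) : ‖D x‖ ≤ B / x := by
  have h := integral_Ioi_of_hasDerivAt_of_tendsto (hD x).continuousAt.continuousWithinAt
    (fun y _ => hD y) hG.integrableOn htop
  rw [zero_sub] at h
  rw [← norm_neg, ← h]
  have hint : ∫ t in Set.Ioi x, B * t ^ (-2 : ℝ) = B / x := by
    rw [integral_const_mul, integral_Ioi_rpow_of_lt (by norm_num) hx]
    norm_num [Real.rpow_neg_one]
    rfl
  rw [← hint]
  refine norm_integral_le_of_norm_le
    ((integrableOn_Ioi_rpow_of_lt (by norm_num) hx).const_mul B) ?_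
  filter_upwards [ae_restrict_mem measurableSet_Ioi] with t ht
  have ht0 : 0 < t := hx.trans ht
  have := hB t
  rw [abs_of_pos ht0] at this
  rw [Real.rpow_neg ht0.le, ← div_eq_mul_inv, le_div_iff₀ (by positivity), mul_comm]
  exact_mod_cast this

lemma exists_norm_le_of_hasDerivAt_schwartzMap {D : ℝ → ℂ} (G : SchwartzMap ℝ ℂ)
    (hD : ∀ x, HasDerivAt D (G x) x) (h0 : D 0 = 0) (hneg : ∀ x, ‖D (-x)‖ = ‖D x‖)
    (htop : Tendsto D atTop (nhds 0)) :
    ∃ C : ℝ, 0 < C ∧ ∀ x, ‖D x‖ ≤ C * |x| ∧ |x| * ‖D x‖ ≤ C := by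
  obtain ⟨A, hA, hA'⟩ := G.decay 0 0
  obtain ⟨B, hB, hB'⟩ := G.decay 2 0
  simp only [pow_zero, one_mul, norm_iteratedFDeriv_zero, Real.norm_eq_abs] at hA' hB'
  refine ⟨max A B, lt_max_of_lt_left hA, fun x => ⟨?_, ?_⟩⟩
  · have := convex_univ.norm_image_sub_le_of_norm_hasDerivWithin_le
      (fun x _ => (hD x).hasDerivWithinAt) (fun x _ => hA' x) (mem_univ 0) (mem_univ x)
    rw [h0, sub_zero, sub_zero, Real.norm_eq_abs] at this
    exact this.trans (by gcongr; exact le_max_left _ _)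
  · refine le_trans ?_ (le_max_right A B)
    have key (t : ℝ) (ht : 0 < t) : t * ‖D t‖ ≤ B := by
      have := norm_le_div_of_hasDerivAt_of_tendsto G.integrable hD htop hB' ht
      rwa [le_div_iff₀ ht, mul_comm] at this
    rcases lt_trichotomy x 0 with hx | rfl | hx
    · rw [abs_of_neg hx, ← hneg]
      exact key _ (neg_pos.2 hx)
    · simpa using hB.le
    · rw [abs_of_pos hx]
      exact key _ hx

lemma contDiff_of_hasDerivAt_schwartzMap {D : ℝ → ℂ} (G : SchwartzMap ℝ ℂ)
    (hD : ∀ x, HasDerivAt D (G x) x) : ContDiff ℝ (⊤ : ℕ∞) D := by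
  rw [contDiff_infty_iff_deriv, show deriv D = G from funext fun x => (hD x).deriv]
  exact ⟨fun x => (hD x).differentiableAt, G.smooth ⊤⟩

/-- Symbol estimates on a dilated annulus for a function with a Schwartz derivative which vanishes
at the origin and at infinity. -/
lemma exists_pow_mul_norm_iteratedDeriv_le {D : ℝ → ℂ} (G : SchwartzMap ℝ ℂ)
    (hD : ∀ x, HasDerivAt D (G x) x) (h0 : D 0 = 0) (hneg : ∀ x, ‖D (-x)‖ = ‖D x‖)
    (htop : Tendsto D atTop (nhds 0)) (j : ℕ) :
    ∃ C : ℝ, 0 < C ∧ ∀ s : ℝ, 0 < s → ∀ η : ℝ, 1 / 2 ≤ |η| → |η| ≤ 2 →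
      s ^ j * ‖iteratedDeriv j D (s * η)‖ ≤ C * min s s⁻¹ := by
  cases j with
  | zero =>
    obtain ⟨C, hC, h⟩ := exists_norm_le_of_hasDerivAt_schwartzMap G hD h0 hneg htop
    refine ⟨2 * C, by positivity, fun s hs η h1 h2 => ?_⟩
    obtain ⟨ha, hb⟩ := h (s * η)
    rw [abs_mul, abs_of_pos hs] at ha hb
    rw [pow_zero, one_mul, iteratedDeriv_zero, mul_min_of_nonneg _ _ (by positivity), le_min_iff]
    constructor
    · refine ha.trans ?_
      nlinarith [mul_pos hC hs]
    · rw [← div_eq_mul_inv, le_div_iff₀ hs]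
      nlinarith [mul_nonneg hs.le (norm_nonneg (D (s * η)))]
  | succ j =>
    obtain ⟨A, hA, hA'⟩ := G.decay 0 j
    obtain ⟨B, hB, hB'⟩ := G.decay (j + 2) j
    simp only [pow_zero, one_mul, norm_iteratedFDeriv_eq_norm_iteratedDeriv, Real.norm_eq_abs]
      at hA' hB'
    refine ⟨max A (2 ^ (j + 2) * B), lt_max_of_lt_left hA, fun s hs η h1 h2 => ?_⟩
    rw [iteratedDeriv_succ', show deriv D = G from funext fun x => (hD x).deriv]
    set d := ‖iteratedDeriv j G (s * η)‖
    have hd : 0 ≤ d := norm_nonneg _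
    rcases le_total s 1 with h | h
    · rw [min_eq_left (h.trans ((one_le_inv₀ hs).2 h))]
      calc s ^ (j + 1) * d ≤ s * A := by
            gcongr
            · exact pow_le_of_le_one hs.le h (by simp)
            · exact hA' _
        _ ≤ _ := by
            rw [mul_comm]
            gcongr
            exact le_max_left _ _
    · rw [min_eq_right ((inv_le_one_of_one_le₀ h).trans h), ← div_eq_mul_inv, le_div_iff₀ hs]
      refine le_trans ?_ (le_max_right _ _)
      calc s ^ (j + 1) * d * s = 2 ^ (j + 2) * ((s * (1 / 2)) ^ (j + 2) * d) := by
            rw [mul_pow, one_div, inv_pow]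
            field_simp
            ring
        _ ≤ 2 ^ (j + 2) * (|s * η| ^ (j + 2) * d) := by
            rw [abs_mul, abs_of_pos hs]
            gcongr
        _ ≤ _ := by
            gcongr
            exact hB' _

lemma hasCompactSupport_of_abs_le {E : Type*} [Zero E] {f : ℝ → E} {R : ℝ}
    (h : ∀ x, f x ≠ 0 → |x| ≤ R) : HasCompactSupport f :=
  HasCompactSupport.intro (isCompact_Icc (a := -R) (b := R)) fun x hx => by
    by_contra hne
    exact hx (abs_le.1 (h x hne))

lemma exists_norm_iteratedDeriv_dilate_mul_le {D : ℝ → ℂ} (G : SchwartzMap ℝ ℂ)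
    (hD : ∀ x, HasDerivAt D (G x) x) (h0 : D 0 = 0) (hneg : ∀ x, ‖D (-x)‖ = ‖D x‖)
    (htop : Tendsto D atTop (nhds 0)) {χ : ℝ → ℂ} (hχsmooth : ContDiff ℝ (⊤ : ℕ∞) χ)
    (hχsupp : ∀ ξ : ℝ, χ ξ ≠ 0 → 1 / 2 ≤ |ξ| ∧ |ξ| ≤ 2) (j : ℕ) :
    ∃ C : ℝ, 0 < C ∧ ∀ s : ℝ, 0 < s → ∀ η : ℝ,
      ‖iteratedDeriv j (fun η => D (s * η) * χ η) η‖ ≤ C * min s s⁻¹ := by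
  have hDs := contDiff_of_hasDerivAt_schwartzMap G hD
  have hcomp : HasCompactSupport χ := hasCompactSupport_of_abs_le fun x hx => (hχsupp x hx).2
  choose A hA hA' using exists_pow_mul_norm_iteratedDeriv_le G hD h0 hneg htop
  choose M hM hM' using (hcomp.toSchwartzMap hχsmooth).decay 0
  simp only [pow_zero, one_mul, norm_iteratedFDeriv_eq_norm_iteratedDeriv] at hM'
  have hsupp (i : ℕ) (η : ℝ) (h : iteratedDeriv i χ η ≠ 0) : 1 / 2 ≤ |η| ∧ |η| ≤ 2 := by
    have hcl : IsClosed {η : ℝ | 1 / 2 ≤ |η| ∧ |η| ≤ 2} :=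
      (isClosed_le continuous_const continuous_abs).inter
        (isClosed_le continuous_abs continuous_const)
    have h' : iteratedFDeriv ℝ i χ η ≠ 0 := by
      rwa [← norm_ne_zero_iff, norm_iteratedFDeriv_eq_norm_iteratedDeriv, norm_ne_zero_iff]
    exact closure_minimal hχsupp hcl (support_iteratedFDeriv_subset i h')
  refine ⟨∑ i ∈ Finset.range (j + 1), (j.choose i) * A i * M (j - i), ?_, fun s hs η => ?_⟩
  · refine Finset.sum_pos (fun i hi => ?_) (by simp)
    have : 0 < j.choose i := Nat.choose_pos (Nat.lt_succ_iff.1 (Finset.mem_range.1 hi))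
    have := hA i
    have := hM (j - i)
    positivity
  · have h1 : ContDiff ℝ (⊤ : ℕ∞) (fun η => D (s * η)) := hDs.comp (contDiff_const.mul contDiff_id)
    rw [iteratedDeriv_fun_mul (h1.contDiffAt.of_le (mod_cast le_top))
      (hχsmooth.contDiffAt.of_le (mod_cast le_top)), Finset.sum_mul]
    refine norm_sum_le_of_le _ fun i _ => ?_
    rw [iteratedDeriv_comp_const_smul (hDs.of_le (mod_cast le_top)), norm_mul, norm_mul,
      Complex.norm_natCast, norm_smul, norm_pow, Real.norm_of_nonneg hs.le]
    have hmin : 0 < min s s⁻¹ := lt_min hs (inv_pos.2 hs)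
    by_cases hz : iteratedDeriv (j - i) χ η = 0
    · have := hA i
      have := hM (j - i)
      rw [hz, norm_zero, mul_zero]
      positivity
    · obtain ⟨h2, h3⟩ := hsupp _ _ hz
      have h4 := hA' i s hs η h2 h3
      have h5 : ‖iteratedDeriv (j - i) χ η‖ ≤ M (j - i) := hM' (j - i) η
      have := hA i
      calc _ ≤ (j.choose i : ℝ) * (A i * min s s⁻¹) * M (j - i) := by gcongr
        _ = _ := by ring

/-- Integration by parts: a bound on the `N`-th derivative gives `N`-th order decay of the
Fourier transform. -/
lemma abs_pow_mul_norm_integral_mul_exp_le {f : ℝ → ℂ} (hf : ContDiff ℝ (⊤ : ℕ∞) f) {R : ℝ}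
    (hR : 0 ≤ R) (hsupp : ∀ x, f x ≠ 0 → |x| ≤ R) {N : ℕ} {B : ℝ}
    (hB : ∀ x, ‖iteratedDeriv N f x‖ ≤ B) (y : ℝ) :
    |y| ^ N * ‖∫ x : ℝ, f x * Complex.exp (-(Complex.I * x * y))‖ ≤ 2 * R * B := by
  have hcomp : HasCompactSupport f := hasCompactSupport_of_abs_le hsupp
  have hts : tsupport f ⊆ Set.Icc (-R) R :=
    closure_minimal (fun x hx => abs_le.1 (hsupp x hx)) isClosed_Icc
  have hz (x : ℝ) (hx : x ∉ Set.Icc (-R) R) : iteratedDeriv N f x = 0 := by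
    by_contra h
    refine hx (hts (support_iteratedFDeriv_subset (𝕜 := ℝ) N ?_))
    rwa [Function.mem_support, ← norm_ne_zero_iff, norm_iteratedFDeriv_eq_norm_iteratedDeriv,
      norm_ne_zero_iff]
  have hint (n : ℕ) : Integrable (iteratedDeriv n f) := by
    refine (hf.continuous_iteratedDeriv n (mod_cast le_top)).integrable_of_hasCompactSupport ?_
    refine HasCompactSupport.intro hcomp fun x hx => ?_
    by_contra h
    refine hx (support_iteratedFDeriv_subset (𝕜 := ℝ) n ?_)
    rwa [Function.mem_support, ← norm_ne_zero_iff, norm_iteratedFDeriv_eq_norm_iteratedDeriv,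
      norm_ne_zero_iff]
  have h1 : ∫ x : ℝ, f x * Complex.exp (-(Complex.I * x * y)) =
      FourierTransform.fourier f (y / (2 * Real.pi)) := by
    rw [Real.fourier_real_eq_integral_exp_smul]
    congr with x
    rw [smul_eq_mul, mul_comm]
    congr 2
    have : (Real.pi : ℂ) ≠ 0 := Complex.ofReal_ne_zero.2 Real.pi_ne_zero
    push_cast
    field_simp
  have h2 := congrFun (Real.fourier_iteratedDeriv (n := N) hf (fun n _ => hint n)
    (mod_cast le_top)) (y / (2 * Real.pi))
  have h3 : |y| ^ N * ‖FourierTransform.fourier f (y / (2 * Real.pi))‖ =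
      ‖FourierTransform.fourier (iteratedDeriv N f) (y / (2 * Real.pi))‖ := by
    have e : 2 * (Real.pi : ℂ) * Complex.I * ((y / (2 * Real.pi) : ℝ) : ℂ) = Complex.I * y := by
      have : (Real.pi : ℂ) ≠ 0 := Complex.ofReal_ne_zero.2 Real.pi_ne_zero
      push_cast
      field_simp
    rw [h2, e, norm_smul, norm_pow, norm_mul, Complex.norm_I, one_mul, Complex.norm_real,
      Real.norm_eq_abs]
  rw [h1, h3, Real.fourier_real_eq_integral_exp_smul,
    ← setIntegral_eq_integral_of_forall_compl_eq_zero (s := Set.Icc (-R) R)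
      fun x hx => by rw [hz x hx, smul_zero]]
  refine (norm_setIntegral_le_of_norm_le_const (C := B) measure_Icc_lt_top fun x _ => ?_).trans_eq ?_
  · rw [norm_smul, Complex.norm_exp_ofReal_mul_I, one_mul]
    exact hB x
  · rw [measureReal_def, Real.volume_Icc, ENNReal.toReal_ofReal (by linarith)]
    ring

lemma le_mul_rpow_neg_of_pow_mul_le {a t A B ν : ℝ} {N : ℕ} (ha : 0 ≤ a) (ht : 0 ≤ t)
    (hν : ν ≤ N) (hA : a ≤ A) (hB : t ^ N * a ≤ B) :
    a ≤ 2 ^ (N - 1) * (A + B) * (1 + t) ^ (-ν) := by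
  have h1 : (1 + t) ^ ν ≤ 2 ^ (N - 1) * (1 + t ^ N) := by
    calc (1 + t) ^ ν ≤ (1 + t) ^ (N : ℝ) := Real.rpow_le_rpow_of_exponent_le (by linarith) hν
      _ = (1 + t) ^ N := Real.rpow_natCast _ _
      _ ≤ 2 ^ (N - 1) * (1 ^ N + t ^ N) := add_pow_le zero_le_one ht N
      _ = _ := by rw [one_pow]
  rw [Real.rpow_neg (by linarith), ← div_eq_mul_inv, le_div_iff₀ (by positivity)]
  calc a * (1 + t) ^ ν ≤ a * (2 ^ (N - 1) * (1 + t ^ N)) := by gcongr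
    _ = 2 ^ (N - 1) * (a + t ^ N * a) := by ring
    _ ≤ _ := by gcongr

lemma two_zpow_neg_abs (k : ℤ) :
    (2 : ℝ) ^ (-|k|) = min ((2 : ℝ) ^ (-k)) ((2 : ℝ) ^ (-k))⁻¹ := by
  rw [← zpow_neg, neg_neg]
  rcases le_total 0 k with h | h
  · rw [abs_of_nonneg h, min_eq_left (zpow_le_zpow_right₀ one_le_two (by linarith))]
  · rw [abs_of_nonpos h, neg_neg, min_eq_right (zpow_le_zpow_right₀ one_le_two (by linarith))]

lemma hatDeltaK_eq (ζ : ℝ → ℝ) (hΨ₀ : ℝ → ℂ) (χ : ℝ → ℝ) (k : ℤ) (η : ℝ) :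
    hatDeltaK ζ hΨ₀ χ k ((2 : ℝ) ^ (-k) * η) = hatD0 ζ hΨ₀ ((2 : ℝ) ^ (-k) * η) * (χ η : ℂ) := by
  rw [hatDeltaK, ← mul_assoc, ← zpow_add₀ two_ne_zero, add_neg_cancel, zpow_zero, one_mul]

lemma norm_deltaK_le (ζ : ℝ → ℝ) (hΨ₀ : ℝ → ℂ) (χ : ℝ → ℝ) (k : ℤ) (y : ℝ) :
    ‖deltaK ζ hΨ₀ χ k y‖ ≤ (2 : ℝ) ^ (-k) *
      ‖∫ η : ℝ, hatD0 ζ hΨ₀ ((2 : ℝ) ^ (-k) * η) * (χ η : ℂ) *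
        Complex.exp (-(Complex.I * η * ((2 : ℝ) ^ (-k) * y : ℝ)))‖ := by
  have hs : (0 : ℝ) < (2 : ℝ) ^ (-k) := by positivity
  have h := Measure.integral_comp_mul_left
    (fun ξ : ℝ => hatDeltaK ζ hΨ₀ χ k ξ * Complex.exp (-(Complex.I * ξ * y))) ((2 : ℝ) ^ (-k))
  have h' : ∫ η : ℝ, hatD0 ζ hΨ₀ ((2 : ℝ) ^ (-k) * η) * (χ η : ℂ) *
        Complex.exp (-(Complex.I * η * ((2 : ℝ) ^ (-k) * y : ℝ))) =
      |((2 : ℝ) ^ (-k))⁻¹| • ∫ ξ : ℝ, hatDeltaK ζ hΨ₀ χ k ξ * Complex.exp (-(Complex.I * ξ * y)) := by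
    rw [← h]
    congr with η
    rw [hatDeltaK_eq]
    congr 3
    push_cast
    ring
  rw [h', norm_smul, Real.norm_eq_abs, abs_abs, abs_inv, abs_of_pos hs, mul_inv_cancel_left₀ hs.ne',
    deltaK, norm_mul]
  refine mul_le_of_le_one_left (norm_nonneg _) ?_
  rw [norm_inv, Complex.norm_real, Real.norm_of_nonneg (by positivity)]
  exact inv_le_one_of_one_le₀ (by linarith [Real.pi_gt_three])

/-- **(2.8)–(2.10)**: the quantitative estimates on the pieces `Δ_k`:
(i) `‖Δ̂_k‖_∞ ≲ 2^{-|k|}`; (ii) `Δ̂_k` is supported in `2^{-k-1} ≤ |ξ| ≤ 2^{-k+1}`;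
(iii) `|Δ_k(y)| ≲ 2^{-k-|k|} (1 + 2^{-k}|y|)^{-ν}`, uniformly in `k ∈ ℤ`. -/
theorem delta_k_symbol_and_spatial_estimates
    (ζ : ℝ → ℝ) (hζsmooth : ContDiff ℝ (⊤ : ℕ∞) ζ) (hζcompact : HasCompactSupport ζ)
    (hζeven : ∀ y : ℝ, ζ (-y) = ζ y) (hζ0 : ζ 0 = 1)
    (hΨ₀ : ℝ → ℂ) (hΨ₀smooth : ContDiff ℝ (⊤ : ℕ∞) hΨ₀)
    (c : ℂ) (hc : c ≠ 0) (hlow : ∀ ξ : ℝ, ξ < -1 → hΨ₀ ξ = c)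
    (hhigh : ∀ ξ : ℝ, -(1 / 2 : ℝ) < ξ → hΨ₀ ξ = 0)
    (hchoice : Tendsto (hatD0 ζ hΨ₀) atTop (nhds 0))
    (χ : ℝ → ℝ) (hχsmooth : ContDiff ℝ (⊤ : ℕ∞) χ)
    (hχsupp : ∀ ξ : ℝ, χ ξ ≠ 0 → 1 / 2 ≤ |ξ| ∧ |ξ| ≤ 2)
    (hχsum : ∀ ξ : ℝ, ξ ≠ 0 → ∑' k : ℤ, χ ((2 : ℝ) ^ k * ξ) = 1) :
    (∃ C : ℝ, 0 < C ∧ ∀ (k : ℤ) (ξ : ℝ),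
        ‖hatDeltaK ζ hΨ₀ χ k ξ‖ ≤ C * (2 : ℝ) ^ (-(|k| : ℤ))) ∧
    (∀ (k : ℤ) (ξ : ℝ), hatDeltaK ζ hΨ₀ χ k ξ ≠ 0 →
        (2 : ℝ) ^ (-k - 1) ≤ |ξ| ∧ |ξ| ≤ (2 : ℝ) ^ (-k + 1)) ∧
    (∀ ν : ℝ, ∃ C : ℝ, 0 < C ∧ ∀ (k : ℤ) (y : ℝ),
        ‖deltaK ζ hΨ₀ χ k y‖ ≤
          C * (2 : ℝ) ^ (-k - |k|) * (1 + (2 : ℝ) ^ (-k) * |y|) ^ (-ν)) := by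
  have hζ := hζsmooth.continuous.integrable_of_hasCompactSupport hζcompact (μ := volume)
  obtain ⟨G, hG⟩ := exists_schwartzMap_hasDerivAt_hatD0 hζsmooth hζcompact hζeven hΨ₀smooth
    hlow hhigh
  have h0 := hatD0_zero hζ hζeven (hhigh 0 (by norm_num))
  have hneg (x : ℝ) : ‖hatD0 ζ hΨ₀ (-x)‖ = ‖hatD0 ζ hΨ₀ x‖ := by
    rw [hatD0_neg hζ hζeven, RCLike.norm_conj]
  have hχ : ContDiff ℝ (⊤ : ℕ∞) (fun η => (χ η : ℂ)) := Complex.ofRealCLM.contDiff.comp hχsmooth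
  have hχ' (ξ : ℝ) (h : (χ ξ : ℂ) ≠ 0) := hχsupp ξ (Complex.ofReal_ne_zero.1 h)
  choose A hA hA' using
    exists_norm_iteratedDeriv_dilate_mul_le G hG h0 hneg hchoice hχ hχ'
  refine ⟨⟨A 0, hA 0, fun k ξ => ?_⟩, fun k ξ h => ?_, fun ν => ?_⟩
  · have h := hA' 0 _ (zpow_pos two_pos (-k)) ((2 : ℝ) ^ k * ξ)
    rw [iteratedDeriv_zero, ← hatDeltaK_eq, ← two_zpow_neg_abs, ← mul_assoc,
      ← zpow_add₀ two_ne_zero, neg_add_cancel, zpow_zero, one_mul] at h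
    exact h
  · obtain ⟨h1, h2⟩ := hχ' _ (right_ne_zero_of_mul h)
    have hk : (0 : ℝ) < 2 ^ k := by positivity
    rw [abs_mul, abs_of_pos hk] at h1 h2
    rw [zpow_sub₀ two_ne_zero, zpow_add₀ two_ne_zero, zpow_neg, zpow_one, inv_mul_eq_div,
      le_div_iff₀ hk, div_le_iff₀ two_pos, inv_le_iff_one_le_mul₀ hk]
    constructor <;> linarith
  · obtain ⟨N, hN⟩ := exists_nat_ge ν
    refine ⟨2 ^ (N - 1) * (2 * 2 * A 0 + 2 * 2 * A N),
      by have := hA 0; have := hA N; positivity, fun k y => ?_⟩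
    have hs : (0 : ℝ) < (2 : ℝ) ^ (-k) := by positivity
    have hsm : ContDiff ℝ (⊤ : ℕ∞) (fun η => hatD0 ζ hΨ₀ ((2 : ℝ) ^ (-k) * η) * (χ η : ℂ)) :=
      ((contDiff_of_hasDerivAt_schwartzMap G hG).comp (contDiff_const.mul contDiff_id)).mul hχ
    have hint (n : ℕ) := abs_pow_mul_norm_integral_mul_exp_le hsm zero_le_two
      (fun x hx => (hχ' x (right_ne_zero_of_mul hx)).2) (hA' n _ hs) ((2 : ℝ) ^ (-k) * y)
    have h1 := hint 0
    have h2 := hint N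
    rw [pow_zero, one_mul] at h1
    rw [← two_zpow_neg_abs] at h1 h2
    refine (norm_deltaK_le ζ hΨ₀ χ k y).trans ?_
    have h3 := le_mul_rpow_neg_of_pow_mul_le (norm_nonneg _) (abs_nonneg _) hN h1 h2
    rw [abs_mul, abs_of_pos hs] at h3
    refine (mul_le_mul_of_nonneg_left h3 hs.le).trans_eq ?_
    rw [sub_eq_add_neg, zpow_add₀ two_ne_zero]
    ring
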